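/- Let F be a field of characteristic zero and let y₁, y₂, t ∈ F satisfy t³ = (y₁² − 1)(y₂² − 1), with y₁ + y₂ ≠ 0, y₂ ≠ 1, y₂ ≠ −1. Set u = t/(y₁ + y₂), X = (y₁² − 1)t³/(y₁ + y₂)⁴, and Y = (y₁²y₂ + 2y₁ + y₂)t⁶/((y₂² − 1)(y₁ + y₂)⁶). Then Y² = X³ + (X − u⁶)². (This is the Weierstrass form of Fibration 4, with singular fibers I₁₈ + 6I₁, on the singular K3 surface X₃.) -/

import Mathlib

/-- Weierstrass form of Fibration 4 (singular fibers `I₁₈ + 6I₁`) on the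
singular K3 surface `X₃` of discriminant 3, as a purely algebraic identity. -/
theorem fibration4_weierstrass_identity (F : Type*) [Field F] [CharZero F]
    (y₁ y₂ t u X Y : F)
    (ht : t ^ 3 = (y₁ ^ 2 - 1) * (y₂ ^ 2 - 1))
    (hsum : y₁ + y₂ ≠ 0) (hy₂ : y₂ ≠ 1) (hy₂' : y₂ ≠ -1)
    (hu : u = t / (y₁ + y₂))
    (hX : X = (y₁ ^ 2 - 1) * t ^ 3 / (y₁ + y₂) ^ 4)
    (hY : Y = (y₁ ^ 2 * y₂ + 2 * y₁ + y₂) * t ^ 6 / ((y₂ ^ 2 - 1) * (y₁ + y₂) ^ 6)) :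
    Y ^ 2 = X ^ 3 + (X - u ^ 6) ^ 2 := by
  have hb : y₂ ^ 2 - 1 ≠ 0 := by
    have h := mul_ne_zero (sub_ne_zero.2 hy₂) (sub_ne_zero.2 hy₂')
    intro h0
    exact h (by linear_combination h0)
  have ht6 : t ^ 6 = ((y₁ ^ 2 - 1) * (y₂ ^ 2 - 1)) ^ 2 := by
    rw [← ht]
    ring
  have hu6 : u ^ 6 = ((y₁ ^ 2 - 1) * (y₂ ^ 2 - 1)) ^ 2 / (y₁ + y₂) ^ 6 := by
    rw [hu, div_pow, ht6]
  have hY' : Y = (y₁ ^ 2 * y₂ + 2 * y₁ + y₂) * (y₁ ^ 2 - 1) ^ 2 * (y₂ ^ 2 - 1) /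
      (y₁ + y₂) ^ 6 := by
    rw [hY, ht6]
    field_simp
  rw [hY', hu6, hX, ht]
  field_simp
  ring
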